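/- arXiv:math/0503679 — 5 statements merged into one kernel-verified Lean document; each statement's English description precedes it below -/
import Mathlib

section
/- Let c > 0 and let d_θθ, d_θγ, d_γθ, d_γγ, s_θθ, s_θγ, s_γγ be real numbers with d_θθ ≠ 0, d_γγ ≠ 0, s_θθ ≠ 0, s_γγ ≠ 0. Suppose D, S : ℝ → Matrix (Fin 2) (Fin 2) ℝ satisfy, entrywise as ε → 0 from the right: D(ε)₁₁ = d_θθ·ε + O(ε²), D(ε)₁₂ = d_θγ·ε + O(ε²), D(ε)₂₁ = d_γθ·ε + O(ε²), D(ε)₂₂ = d_γγ + O(ε), S(ε)₁₁ = s_θθ·ε + O(ε²), S(ε)₁₂ = s_θγ·ε + O(ε²), S(ε)₂₁ = s_θγ·ε + O(ε²), S(ε)₂₂ = s_γγ + O(ε). Then there exists ε₁ > 0 such that for every ε ∈ (0, ε₁) the matrices D(ε) and S(ε) are invertible, and the matrix Ω(ε) := ε·c·(D(ε)ᵀ · S(ε)⁻¹ · D(ε))⁻¹ satisfies, as ε → 0 from the right: Ω(ε)₁₁ = c·s_θθ/d_θθ² + O(ε), Ω(ε)₁₂ = O(ε), Ω(ε)₂₁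 = O(ε), and Ω(ε)₂₂ = ε·c·s_γγ/d_γγ² + O(ε²). -/
open Filter Asymptotics Topology Matrix

/-- `f ε = a + O(ε)` as `ε → 0` from the right. -/
def IsConstAddBigO (f : ℝ → ℝ) (a : ℝ) : Prop :=
  (fun ε => f ε - a) =O[𝓝[>] (0 : ℝ)] fun ε => ε

namespace IsConstAddBigO

variable {f g : ℝ → ℝ} {a b : ℝ}

theorem tendsto (hf : IsConstAddBigO f a) : Tendsto f (𝓝[>] 0) (𝓝 a) := by
  have h : Tendsto (fun ε => f ε - a) (𝓝[>] 0) (𝓝 0) :=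
    IsBigO.trans_tendsto hf (tendsto_id.mono_left nhdsWithin_le_nhds)
  simpa using h.add_const a

theorem isBigO_one (hf : IsConstAddBigO f a) : f =O[𝓝[>] 0] fun _ => (1 : ℝ) :=
  hf.tendsto.isBigO_one ℝ

theorem const (a : ℝ) : IsConstAddBigO (fun _ => a) a := by
  simpa [IsConstAddBigO] using isBigO_zero (fun ε : ℝ => ε) (𝓝[>] (0 : ℝ))

theorem id : IsConstAddBigO (fun ε => ε) 0 := by
  simpa [IsConstAddBigO] using isBigO_refl (fun ε : ℝ => ε) (𝓝[>] (0 : ℝ))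

theorem add (hf : IsConstAddBigO f a) (hg : IsConstAddBigO g b) :
    IsConstAddBigO (fun ε => f ε + g ε) (a + b) :=
  (IsBigO.add hf hg).congr_left fun ε => by ring

theorem sub (hf : IsConstAddBigO f a) (hg : IsConstAddBigO g b) :
    IsConstAddBigO (fun ε => f ε - g ε) (a - b) :=
  (IsBigO.sub hf hg).congr_left fun ε => by ring

theorem mul (hf : IsConstAddBigO f a) (hg : IsConstAddBigO g b) :
    IsConstAddBigO (fun ε => f ε * g ε) (a * b) := by
  have h₁ : (fun ε => (f ε - a) * g ε) =O[𝓝[>] 0] fun ε => ε * 1 := IsBigO.mul hf hg.isBigO_one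
  have h₂ : (fun ε => a * (g ε - b)) =O[𝓝[>] 0] fun ε => ε := IsBigO.const_mul_left hg a
  simp only [mul_one] at h₁
  exact (h₁.add h₂).congr_left fun ε => by ring

theorem inv (hf : IsConstAddBigO f a) (ha : a ≠ 0) :
    IsConstAddBigO (fun ε => (f ε)⁻¹) a⁻¹ := by
  have h₁ : (fun ε => (f ε - a) * (f ε)⁻¹) =O[𝓝[>] 0] fun ε => ε * 1 :=
    IsBigO.mul hf ((hf.tendsto.inv₀ ha).isBigO_one ℝ)
  simp only [mul_one] at h₁
  refine (h₁.const_mul_left (-a⁻¹)).congr' ?_ EventuallyEq.rfl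
  filter_upwards [hf.tendsto.eventually_ne ha] with ε hε
  field_simp
  ring

theorem congr' (hf : IsConstAddBigO f a) (h : f =ᶠ[𝓝[>] 0] g) (hab : a = b) :
    IsConstAddBigO g b := by
  subst hab
  refine IsBigO.congr' hf ?_ EventuallyEq.rfl
  filter_upwards [h] with ε hε
  rw [hε]

theorem id_mul_isBigO (hf : IsConstAddBigO f a) :
    (fun ε => ε * f ε) =O[𝓝[>] 0] fun ε => ε := by
  simpa using (isBigO_refl (fun ε : ℝ => ε) (𝓝[>] 0)).mul hf.isBigO_one

theorem id_mul_sub_isBigO (hf : IsConstAddBigO f a) :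
    (fun ε => ε * f ε - ε * a) =O[𝓝[>] 0] fun ε => ε ^ 2 :=
  ((isBigO_refl (fun ε : ℝ => ε) (𝓝[>] 0)).mul hf).congr
    (fun ε => by ring) fun ε => by ring

theorem div_id (hf : (fun ε => f ε - a * ε) =O[𝓝[>] (0 : ℝ)] fun ε => ε ^ 2) :
    IsConstAddBigO (fun ε => f ε / ε) a := by
  refine (hf.mul (isBigO_refl (fun ε : ℝ => ε⁻¹) (𝓝[>] 0))).congr' ?_ ?_ <;>
  · filter_upwards [self_mem_nhdsWithin] with ε hε
    have hε' : ε ≠ 0 := ne_of_gt hε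
    field_simp

end IsConstAddBigO

theorem Matrix.inv_transpose_mul_inv_mul {n R : Type*} [Fintype n] [DecidableEq n] [Field R]
    (A B : Matrix n n R) (hB : IsUnit B) :
    (Aᵀ * B⁻¹ * A)⁻¹ = (A.det ^ 2)⁻¹ • (A.adjugate * B * A.adjugateᵀ) := by
  rw [mul_inv_rev, mul_inv_rev, nonsing_inv_nonsing_inv _ ((isUnit_iff_isUnit_det B).1 hB),
    ← transpose_nonsing_inv, inv_def, Ring.inverse_eq_inv']
  simp only [transpose_smul, Matrix.smul_mul, Matrix.mul_smul, smul_smul, Matrix.mul_assoc]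
  rw [sq, mul_inv]

/-- Theorem 1, part 3 (joint estimation of drift and diffusion parameters), leading order:
with entrywise expansions `D(ε)₁₁ = d_θθ·ε + O(ε²)`, `D(ε)₁₂ = d_θγ·ε + O(ε²)`,
`D(ε)₂₁ = d_γθ·ε + O(ε²)`, `D(ε)₂₂ = d_γγ + O(ε)` and similarly for `S`, the matrices
`D(ε)`, `S(ε)` are invertible for small `ε > 0`, and the asymptotic variance matrix
`Ω(ε) = ε·c·(D(ε)ᵀ S(ε)⁻¹ D(ε))⁻¹` satisfies `Ω₁₁ = c·s_θθ/d_θθ² + O(ε)`,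
`Ω₁₂ = O(ε)`, `Ω₂₁ = O(ε)` and `Ω₂₂ = ε·c·s_γγ/d_γγ² + O(ε²)`. -/
theorem variance_expansion_joint
    (c dθθ dθγ dγθ dγγ sθθ sθγ sγγ : ℝ) (hc : 0 < c)
    (hdθθ : dθθ ≠ 0) (hdγγ : dγγ ≠ 0) (hsθθ : sθθ ≠ 0) (hsγγ : sγγ ≠ 0)
    (D S : ℝ → Matrix (Fin 2) (Fin 2) ℝ)
    (hD11 : (fun ε => D ε 0 0 - dθθ * ε) =O[𝓝[>] (0 : ℝ)] fun ε => ε ^ 2)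
    (hD12 : (fun ε => D ε 0 1 - dθγ * ε) =O[𝓝[>] (0 : ℝ)] fun ε => ε ^ 2)
    (hD21 : (fun ε => D ε 1 0 - dγθ * ε) =O[𝓝[>] (0 : ℝ)] fun ε => ε ^ 2)
    (hD22 : (fun ε => D ε 1 1 - dγγ) =O[𝓝[>] (0 : ℝ)] fun ε => ε)
    (hS11 : (fun ε => S ε 0 0 - sθθ * ε) =O[𝓝[>] (0 : ℝ)] fun ε => ε ^ 2)
    (hS12 : (fun ε => S ε 0 1 - sθγ * ε) =O[𝓝[>] (0 : ℝ)] fun ε => ε ^ 2)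
    (hS21 : (fun ε => S ε 1 0 - sθγ * ε) =O[𝓝[>] (0 : ℝ)] fun ε => ε ^ 2)
    (hS22 : (fun ε => S ε 1 1 - sγγ) =O[𝓝[>] (0 : ℝ)] fun ε => ε) :
    ∃ ε₁ > (0 : ℝ),
      (∀ ε ∈ Set.Ioo (0 : ℝ) ε₁, IsUnit (D ε) ∧ IsUnit (S ε)) ∧
      ((fun ε => ((ε * c) • ((D ε)ᵀ * (S ε)⁻¹ * D ε)⁻¹) 0 0 - c * sθθ / dθθ ^ 2)
          =O[𝓝[>] (0 : ℝ)] fun ε => ε) ∧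
      ((fun ε => ((ε * c) • ((D ε)ᵀ * (S ε)⁻¹ * D ε)⁻¹) 0 1)
          =O[𝓝[>] (0 : ℝ)] fun ε => ε) ∧
      ((fun ε => ((ε * c) • ((D ε)ᵀ * (S ε)⁻¹ * D ε)⁻¹) 1 0)
          =O[𝓝[>] (0 : ℝ)] fun ε => ε) ∧
      ((fun ε => ((ε * c) • ((D ε)ᵀ * (S ε)⁻¹ * D ε)⁻¹) 1 1 - ε * c * sγγ / dγγ ^ 2)
          =O[𝓝[>] (0 : ℝ)] fun ε => ε ^ 2) := by
  have ha := IsConstAddBigO.div_id hD11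
  have hb := IsConstAddBigO.div_id hD12
  have he := IsConstAddBigO.div_id hD21
  have hf : IsConstAddBigO (fun ε => D ε 1 1) dγγ := hD22
  have hp := IsConstAddBigO.div_id hS11
  have hq := IsConstAddBigO.div_id hS12
  have hr := IsConstAddBigO.div_id hS21
  have ht : IsConstAddBigO (fun ε => S ε 1 1) sγγ := hS22
  set a : ℝ → ℝ := fun ε => D ε 0 0 / ε with a_def
  set b : ℝ → ℝ := fun ε => D ε 0 1 / ε with b_def
  set e : ℝ → ℝ := fun ε => D ε 1 0 / ε with e_def
  set f : ℝ → ℝ := fun ε => D ε 1 1 with f_def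
  set p : ℝ → ℝ := fun ε => S ε 0 0 / ε with p_def
  set q : ℝ → ℝ := fun ε => S ε 0 1 / ε with q_def
  set r : ℝ → ℝ := fun ε => S ε 1 0 / ε with r_def
  set t : ℝ → ℝ := fun ε => S ε 1 1 with t_def
  have hpos : ∀ᶠ ε : ℝ in 𝓝[>] 0, ε ≠ 0 := by
    filter_upwards [self_mem_nhdsWithin] with ε hε using ne_of_gt hε
  have hDε : ∀ᶠ ε in 𝓝[>] 0, D ε = !![ε * a ε, ε * b ε; ε * e ε, f ε] := by
    filter_upwards [hpos] with ε hε
    ext i j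
    fin_cases i <;> fin_cases j <;> simp [a_def, b_def, e_def, f_def, mul_div_cancel₀, hε]
  have hSε : ∀ᶠ ε in 𝓝[>] 0, S ε = !![ε * p ε, ε * q ε; ε * r ε, t ε] := by
    filter_upwards [hpos] with ε hε
    ext i j
    fin_cases i <;> fin_cases j <;> simp [p_def, q_def, r_def, t_def, mul_div_cancel₀, hε]
  clear_value a b e f p q r t
  have hm := (ha.mul hf).sub (IsConstAddBigO.id.mul (hb.mul he))
  have hn := (hp.mul ht).sub (IsConstAddBigO.id.mul (hq.mul hr))
  have hm0 : dθθ * dγγ - 0 * (dθγ * dγθ) ≠ 0 := by simp [hdθθ, hdγγ]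
  have hn0 : sθθ * sγγ - 0 * (sθγ * sθγ) ≠ 0 := by simp [hsθθ, hsγγ]
  have hDunit : ∀ᶠ ε in 𝓝[>] 0, IsUnit (D ε) := by
    filter_upwards [hpos, hDε, hm.tendsto.eventually_ne hm0] with ε hε h h'
    rw [isUnit_iff_isUnit_det, isUnit_iff_ne_zero, h, det_fin_two_of]
    convert mul_ne_zero hε h' using 1
    ring
  have hSunit : ∀ᶠ ε in 𝓝[>] 0, IsUnit (S ε) := by
    filter_upwards [hpos, hSε, hn.tendsto.eventually_ne hn0] with ε hε h h'
    rw [isUnit_iff_isUnit_det, isUnit_iff_ne_zero, h, det_fin_two_of]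
    convert mul_ne_zero hε h' using 1
    ring
  have hk := (IsConstAddBigO.const c).mul ((hm.mul hm).inv (mul_ne_zero hm0 hm0))
  have h00 := hk.mul ((((hf.mul hf).mul hp).sub
    (IsConstAddBigO.id.mul ((hf.mul hb).mul (hq.add hr)))).add
    (IsConstAddBigO.id.mul ((hb.mul hb).mul ht)))
  have h01 := hk.mul ((((hf.mul hq).mul ha).sub ((hf.mul hp).mul he)).add
    ((IsConstAddBigO.id.mul ((hb.mul hr).mul he)).sub ((hb.mul ha).mul ht)))
  have h10 := hk.mul ((((hf.mul hr).mul ha).sub ((hf.mul hp).mul he)).add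
    ((IsConstAddBigO.id.mul ((hb.mul hq).mul he)).sub ((hb.mul ha).mul ht)))
  have h11 := hk.mul ((((ha.mul ha).mul ht).sub
    (IsConstAddBigO.id.mul ((he.mul ha).mul (hq.add hr)))).add
    (IsConstAddBigO.id.mul ((he.mul he).mul hp)))
  have hΩ : ∀ᶠ ε in 𝓝[>] 0, (ε * c) • ((D ε)ᵀ * (S ε)⁻¹ * D ε)⁻¹ =
      (ε * c * ((ε * (a ε * f ε - ε * (b ε * e ε))) ^ 2)⁻¹) •
        (!![f ε, -(ε * b ε); -(ε * e ε), ε * a ε] * !![ε * p ε, ε * q ε; ε * r ε, t ε] *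
          !![f ε, -(ε * b ε); -(ε * e ε), ε * a ε]ᵀ) := by
    filter_upwards [hDε, hSε, hSunit] with ε hD hS hu
    rw [inv_transpose_mul_inv_mul _ _ hu, hD, hS, adjugate_fin_two_of, det_fin_two_of, smul_smul]
    congr 4
    ring
  obtain ⟨ε₁, hε₁, hunit⟩ := mem_nhdsGT_iff_exists_Ioo_subset.1 (hDunit.and hSunit)
  refine ⟨ε₁, hε₁, fun ε hε => hunit hε, h00.congr' ?_ (by field_simp; ring),
    h01.id_mul_isBigO.congr' ?_ EventuallyEq.rfl, h10.id_mul_isBigO.congr' ?_ EventuallyEq.rfl,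
    h11.id_mul_sub_isBigO.congr' ?_ EventuallyEq.rfl⟩
  all_goals
    filter_upwards [hpos, hΩ, hm.tendsto.eventually_ne hm0] with ε hε h h'
    simp only [h]
    simp only [Matrix.smul_apply, Matrix.mul_apply, Matrix.transpose_apply, Fin.sum_univ_two,
      smul_eq_mul, of_apply, cons_val', cons_val_zero, cons_val_one, cons_val_fin_one]
    field_simp
    ring
end

section
/- Let I ⊆ ℝ be an open interval, x₀ ∈ I, and let μ, σ, q : I → ℝ be continuous with σ(y) > 0 for all y ∈ I. Define the scale density s(y) := exp(−2·∫_{x₀}^{y} μ(u)/σ(u)² du) and, for constants C₁, C₂ ∈ ℝ, define ř(y) := C₂ + ∫_{x₀}^{y} s(z)·( C₁ − ∫_{x₀}^{z} 2·q(x)/(σ(x)²·s(x)) dx ) dz. Then ř is twice differentiable on I and, for every y ∈ I, μ(y)·ř′(y) + (σ(y)²/2)·ř″(y) = −q(y). -/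
open MeasureTheory intervalIntegral

/-- Fundamental theorem of calculus for an integrand continuous on an open interval. -/
theorem hasDerivAt_integral_of_continuousOn_ordConnected {I : Set ℝ} (hI : IsOpen I)
    (hc : I.OrdConnected) {f : ℝ → ℝ} (hf : ContinuousOn f I) {a y : ℝ} (ha : a ∈ I)
    (hy : y ∈ I) : HasDerivAt (fun t => ∫ u in a..t, f u) (f y) y :=
  integral_hasDerivAt_right ((hf.mono (hc.uIcc_subset ha hy)).intervalIntegrable)
    (hf.stronglyMeasurableAtFilter hI y hy) (hf.continuousAt (hI.mem_nhds hy))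

/-- Lemma 2 (equations (31), (63), (64)): with scale density
`s(y) = exp(−2∫_{x₀}^y μ/σ²)`, the function
`rck(y) = C₂ + ∫_{x₀}^y s(z)·(C₁ − ∫_{x₀}^z 2q/(σ²·s)) dz`
is twice differentiable on the open interval `I` and solves the generator equation
`μ·rck′ + (σ²/2)·rck″ = −q` there. -/
theorem generator_equation_solution
    (I : Set ℝ) (hIopen : IsOpen I) (hIconn : I.OrdConnected)
    (x₀ : ℝ) (hx₀ : x₀ ∈ I)
    (μ σ q : ℝ → ℝ)
    (hμ : ContinuousOn μ I) (hσ : ContinuousOn σ I) (hq : ContinuousOn q I)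
    (hσpos : ∀ y ∈ I, 0 < σ y)
    (s : ℝ → ℝ) (hs : ∀ y, s y = Real.exp (-2 * ∫ u in x₀..y, μ u / σ u ^ 2))
    (C₁ C₂ : ℝ)
    (rck : ℝ → ℝ)
    (hrck : ∀ y, rck y = C₂ + ∫ z in x₀..y, s z * (C₁ - ∫ x in x₀..z, 2 * q x / (σ x ^ 2 * s x))) :
    ∀ y ∈ I, DifferentiableAt ℝ rck y ∧ DifferentiableAt ℝ (deriv rck) y ∧
      μ y * deriv rck y + σ y ^ 2 / 2 * deriv (deriv rck) y = -q y := by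
  have hs_pos : ∀ y, 0 < s y := fun y => hs y ▸ Real.exp_pos _
  have hs_deriv : ∀ y ∈ I, HasDerivAt s (s y * (-2 * (μ y / σ y ^ 2))) y := by
    intro y hy
    have hcont : ContinuousOn (fun u => μ u / σ u ^ 2) I :=
      hμ.div (hσ.pow 2) fun u hu => (pow_pos (hσpos u hu) 2).ne'
    have h := ((hasDerivAt_integral_of_continuousOn_ordConnected hIopen hIconn hcont hx₀
      hy).const_mul (-2)).exp
    rw [← hs y] at h
    exact h.congr_of_eventuallyEq (.of_forall hs)
  have hs_cont : ContinuousOn s I := fun y hy =>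
    (hs_deriv y hy).continuousAt.continuousWithinAt
  set g : ℝ → ℝ := fun z => s z * (C₁ - ∫ x in x₀..z, 2 * q x / (σ x ^ 2 * s x)) with hg
  have hg_deriv : ∀ y ∈ I, HasDerivAt g
      (s y * (-2 * (μ y / σ y ^ 2)) * (C₁ - ∫ x in x₀..y, 2 * q x / (σ x ^ 2 * s x)) +
        s y * -(2 * q y / (σ y ^ 2 * s y))) y := by
    intro y hy
    have hcont : ContinuousOn (fun x => 2 * q x / (σ x ^ 2 * s x)) I :=
      (continuousOn_const.mul hq).div ((hσ.pow 2).mul hs_cont) fun x hx =>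
        (mul_pos (pow_pos (hσpos x hx) 2) (hs_pos x)).ne'
    exact (hs_deriv y hy).mul ((hasDerivAt_integral_of_continuousOn_ordConnected hIopen
      hIconn hcont hx₀ hy).const_sub C₁)
  have hg_cont : ContinuousOn g I := fun y hy =>
    (hg_deriv y hy).continuousAt.continuousWithinAt
  have hrck_deriv : ∀ y ∈ I, HasDerivAt rck (g y) y := fun y hy =>
    ((hasDerivAt_integral_of_continuousOn_ordConnected hIopen hIconn hg_cont hx₀
      hy).const_add C₂).congr_of_eventuallyEq (.of_forall hrck)
  intro y hy
  have hderiv2 := (hg_deriv y hy).congr_of_eventuallyEq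
    (Filter.eventuallyEq_of_mem (hIopen.mem_nhds hy) fun z hz => (hrck_deriv z hz).deriv)
  refine ⟨(hrck_deriv y hy).differentiableAt, hderiv2.differentiableAt, ?_⟩
  rw [(hrck_deriv y hy).deriv, hderiv2.deriv, hg]
  have hσ_ne := (hσpos y hy).ne'
  have hs_ne := (hs_pos y).ne'
  field_simp
  ring
end

section
/- Let σ, g : ℝ → ℝ be continuously differentiable with σ(y) > 0 for all y, and let y₀ ∈ ℝ and μ₀ ∈ ℝ. Define a(y) := ∫_{y₀}^{y} du/σ(u), b(y) := ∫_{y₀}^{y} g(u)/σ(u)² du, c(y) := g(y)/σ(y), and H(y, δ) := a(y)·b(y) − δ·c(y). Then: (i) H(y₀, 0) = 0; (ii) ∂H/∂y evaluated at (y₀, 0) equals 0; and (iii) ∂H/∂δ(y₀, 0) + μ₀·(∂H/∂y)(y₀, 0) + (σ(y₀)²/2)·(∂²H/∂y²)(y₀, 0) = 0. In particular the operator A·f = ∂f/∂δ + μ₀·∂f/∂y + (σ²/2)·∂²f/∂y² annihilates H at the point (y₀, 0). -/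
open MeasureTheory intervalIntegral

/-- Section 3.2, conditions (19) and `A_{β₀}·H = 0` for the choice (21) of the singular
part of the likelihood score: with `a(y) = ∫_{y₀}^y du/σ(u)`, `b(y) = ∫_{y₀}^y g/σ²`,
`c(y) = g(y)/σ(y)` and `H(y, δ) = a(y)b(y) − δ·c(y)`, the function `H`, its first
derivative in `y`, and `(∂/∂δ + μ₀·∂/∂y + (σ²/2)·∂²/∂y²)H` all vanish at `(y₀, 0)`. -/
theorem singular_part_annihilated
    (σ g : ℝ → ℝ) (hσ : ContDiff ℝ 1 σ) (hg : ContDiff ℝ 1 g)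
    (hσpos : ∀ y, 0 < σ y) (y₀ μ₀ : ℝ)
    (a b c : ℝ → ℝ)
    (ha : ∀ y, a y = ∫ u in y₀..y, 1 / σ u)
    (hb : ∀ y, b y = ∫ u in y₀..y, g u / σ u ^ 2)
    (hc : ∀ y, c y = g y / σ y)
    (H : ℝ → ℝ → ℝ)
    (hH : ∀ y δ, H y δ = a y * b y - δ * c y) :
    H y₀ 0 = 0 ∧
    deriv (fun y => H y 0) y₀ = 0 ∧
    deriv (fun δ => H y₀ δ) 0 + μ₀ * deriv (fun y => H y 0) y₀ +
        σ y₀ ^ 2 / 2 * deriv (deriv fun y => H y 0) y₀ = 0 := by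
  have hσne : ∀ y, σ y ≠ 0 := fun y => (hσpos y).ne'
  have hσd : Differentiable ℝ σ := hσ.differentiable one_ne_zero
  have hgd : Differentiable ℝ g := hg.differentiable one_ne_zero
  have ha'd : Differentiable ℝ fun u => 1 / σ u :=
    (differentiable_const 1).div hσd hσne
  have hb'd : Differentiable ℝ fun u => g u / σ u ^ 2 :=
    hgd.div (hσd.pow 2) fun y => pow_ne_zero 2 (hσne y)
  have hda : ∀ y, HasDerivAt a (1 / σ y) y := fun y => by
    rw [funext ha]
    exact ha'd.continuous.integral_hasStrictDerivAt y₀ y |>.hasDerivAt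
  have hdb : ∀ y, HasDerivAt b (g y / σ y ^ 2) y := fun y => by
    rw [funext hb]
    exact hb'd.continuous.integral_hasStrictDerivAt y₀ y |>.hasDerivAt
  have ha0 : a y₀ = 0 := by simp [ha]
  have hb0 : b y₀ = 0 := by simp [hb]
  have hH0 : (fun y => H y 0) = a * b := by
    funext y
    simp [hH]
  have hdH : deriv (a * b) = fun y => 1 / σ y * b y + a y * (g y / σ y ^ 2) :=
    funext fun y => ((hda y).mul (hdb y)).deriv
  have hd2H : deriv (deriv (a * b)) y₀ = 2 * (1 / σ y₀ * (g y₀ / σ y₀ ^ 2)) := by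
    rw [hdH]
    refine (((ha'd y₀).hasDerivAt.mul (hdb y₀)).add
      ((hda y₀).mul (hb'd y₀).hasDerivAt)).deriv.trans ?_
    rw [ha0, hb0]
    ring
  have hdδ : deriv (fun δ => H y₀ δ) 0 = -(g y₀ / σ y₀) := by
    have h : (fun δ => H y₀ δ) = fun δ => -(g y₀ / σ y₀) * δ := by
      funext δ
      rw [hH, ha0, hc]
      ring
    rw [h]
    simp
  have hdH0 : deriv (a * b) y₀ = 0 := by simp [hdH, ha0, hb0]
  refine ⟨by simp [hH, ha0], by rw [hH0, hdH0], ?_⟩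
  rw [hH0, hdδ, hdH0, hd2H]
  have := hσne y₀
  field_simp
  ring
end

section
/- Let θ > 0 and let Δ₀ be a nonnegative random variable with E[Δ₀] > 0 and E[Δ₀³] < ∞. Then, as ε → 0 from the right, E[1 − e^{−θ·ε·Δ₀}]/(ε·E[Δ₀]) = θ − ε·θ²·E[Δ₀²]/(2·E[Δ₀]) + O(ε²). -/
open MeasureTheory Filter Asymptotics Topology

theorem abs_one_sub_exp_neg_sub_le {x : ℝ} (hx : 0 ≤ x) :
    |1 - Real.exp (-x) - (x - x ^ 2 / 2)| ≤ x ^ 3 := by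
  rcases le_total x 1 with h | h
  · have hb := Real.exp_bound (x := -x) (by rwa [abs_neg, abs_of_nonneg hx]) (n := 3) (by norm_num)
    rw [abs_neg, abs_of_nonneg hx] at hb
    norm_num [Finset.sum_range_succ, Nat.factorial] at hb
    have h3 : 0 ≤ x ^ 3 := by positivity
    rw [abs_le] at hb ⊢
    constructor <;> linarith [hb.1, hb.2]
  · have h0 := Real.exp_pos (-x)
    have h1 : Real.exp (-x) ≤ 1 := Real.exp_le_one_iff.mpr (by linarith)
    have h2 : x ≤ x ^ 2 := by nlinarith
    have h3 : x ^ 2 ≤ x ^ 3 := by nlinarith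
    rw [abs_le]
    constructor <;> linarith

theorem MeasureTheory.Integrable.pow_of_le {Ω : Type*} [MeasurableSpace Ω] {μ : Measure Ω}
    [IsFiniteMeasure μ] {X : Ω → ℝ} (hX : AEStronglyMeasurable X μ) {m n : ℕ} (hmn : m ≤ n)
    (h : Integrable (fun ω => X ω ^ n) μ) : Integrable (fun ω => X ω ^ m) μ := by
  refine ((integrable_const (1 : ℝ)).add h.norm).mono' (hX.pow m) (ae_of_all _ fun ω => ?_)
  simp only [Pi.add_apply, norm_pow]
  rcases le_total ‖X ω‖ 1 with h1 | h1
  · linarith [pow_le_one₀ (n := m) (norm_nonneg (X ω)) h1, pow_nonneg (norm_nonneg (X ω)) n]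
  · linarith [pow_le_pow_right₀ h1 hmn]

theorem abs_integral_one_sub_exp_sub_le {Ω : Type*} [MeasurableSpace Ω] {μ : Measure Ω}
    [IsFiniteMeasure μ] {X : Ω → ℝ} (hX : AEStronglyMeasurable X μ) (hX0 : ∀ ω, 0 ≤ X ω)
    (h : Integrable (fun ω => X ω ^ 3) μ) {t : ℝ} (ht : 0 ≤ t) :
    |∫ ω, (1 - Real.exp (-(t * X ω))) ∂μ -
        (t * ∫ ω, X ω ∂μ - t ^ 2 * (∫ ω, X ω ^ 2 ∂μ) / 2)| ≤ t ^ 3 * ∫ ω, X ω ^ 3 ∂μ := by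
  have i1 : Integrable X μ := by
    simpa using Integrable.pow_of_le hX (m := 1) (by norm_num) h
  have i2 := Integrable.pow_of_le hX (m := 2) (by norm_num) h
  have ie : Integrable (fun ω => 1 - Real.exp (-(t * X ω))) μ := by
    refine (integrable_const (1 : ℝ)).sub ((integrable_const (1 : ℝ)).mono'
      (Real.continuous_exp.comp_aestronglyMeasurable (hX.const_mul t).neg)
      (ae_of_all _ fun ω => ?_))
    rw [Real.norm_eq_abs, Real.abs_exp, Real.exp_le_one_iff]
    exact neg_nonpos.mpr (mul_nonneg ht (hX0 ω))
  have ip : Integrable (fun ω => t * X ω - t ^ 2 / 2 * X ω ^ 2) μ :=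
    (i1.const_mul t).sub (i2.const_mul (t ^ 2 / 2))
  have hp : ∫ ω, (t * X ω - t ^ 2 / 2 * X ω ^ 2) ∂μ =
      t * ∫ ω, X ω ∂μ - t ^ 2 * (∫ ω, X ω ^ 2 ∂μ) / 2 := by
    rw [integral_sub (i1.const_mul t) (i2.const_mul _), integral_const_mul, integral_const_mul]
    ring
  rw [← hp, ← integral_sub ie ip, ← integral_const_mul, ← Real.norm_eq_abs]
  refine norm_integral_le_of_norm_le (h.const_mul _) (ae_of_all _ fun ω => ?_)
  convert! abs_one_sub_exp_neg_sub_le (mul_nonneg ht (hX0 ω)) using 1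
  · rw [Real.norm_eq_abs]
    ring_nf
  · ring

/-- Table 1 (bias of the Euler drift estimator for the Ornstein–Uhlenbeck process):
if `Δ₀ ≥ 0` with `E[Δ₀] > 0` and `E[Δ₀³] < ∞`, then as `ε → 0⁺`,
`E[1 − e^{−θεΔ₀}]/(ε·E[Δ₀]) = θ − ε·θ²·E[Δ₀²]/(2E[Δ₀]) + O(ε²)`. -/
theorem euler_drift_bias_expansion
    {Ω : Type*} [MeasurableSpace Ω] (P : Measure Ω) [IsProbabilityMeasure P]
    (θ : ℝ) (hθ : 0 < θ)
    (Δ₀ : Ω → ℝ) (hΔ₀meas : Measurable Δ₀) (hΔ₀pos : ∀ ω, 0 ≤ Δ₀ ω)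
    (hΔ₀cube : Integrable (fun ω => Δ₀ ω ^ 3) P)
    (hΔ₀mean : 0 < ∫ ω, Δ₀ ω ∂P) :
    (fun ε => (∫ ω, (1 - Real.exp (-θ * ε * Δ₀ ω)) ∂P) / (ε * ∫ ω, Δ₀ ω ∂P) -
        (θ - ε * θ ^ 2 * (∫ ω, Δ₀ ω ^ 2 ∂P) / (2 * ∫ ω, Δ₀ ω ∂P)))
      =O[𝓝[>] (0 : ℝ)] fun ε => ε ^ 2 := by
  refine IsBigO.of_bound (θ ^ 3 * (∫ ω, Δ₀ ω ^ 3 ∂P) / ∫ ω, Δ₀ ω ∂P) ?_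
  filter_upwards [self_mem_nhdsWithin] with ε hε
  have hε : 0 < ε := hε
  have key := abs_integral_one_sub_exp_sub_le hΔ₀meas.aestronglyMeasurable hΔ₀pos hΔ₀cube
    (mul_pos hθ hε).le
  simp only [neg_mul, Real.norm_eq_abs, abs_pow, abs_of_pos hε]
  set m := ∫ ω, Δ₀ ω ∂P
  set s := ∫ ω, Δ₀ ω ^ 2 ∂P
  set c := ∫ ω, Δ₀ ω ^ 3 ∂P
  set N := ∫ ω, (1 - Real.exp (-(θ * ε * Δ₀ ω))) ∂P
  have hN : N / (ε * m) - (θ - ε * θ ^ 2 * s / (2 * m)) =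
      (N - (θ * ε * m - (θ * ε) ^ 2 * s / 2)) / (ε * m) := by
    field_simp
  have hεm : 0 < ε * m := mul_pos hε hΔ₀mean
  rw [hN, abs_div, abs_of_pos hεm, div_le_iff₀ hεm]
  refine key.trans_eq ?_
  field_simp
end

section
/- Let θ₀ > 0 and σ₀² > 0. On a probability space, let Y₀ be a real random variable, Δ a strictly positive integrable random variable, and G a standard Gaussian N(0, 1), with G independent of the pair (Y₀, Δ). Define Y₁ := e^{−θ₀Δ}·Y₀ + √(σ₀²·(1 − e^{−2θ₀Δ})/(2θ₀))·G, and for v > 0 define h(v) := (1/(2v))·( (Y₁ − e^{−θ₀Δ}·Y₀)²·(2θ₀)/(v·(1 − e^{−2θ₀Δ})) − 1 ). Then E[h(σ₀²)²] = 1/(2σ₀⁴) and E[(∂h/∂v)(σ₀²)] = −1/(2σ₀⁴); consequently E[Δ]·E[h(σ₀²)²]/(E[(∂h/∂v)(σ₀²)])² = 2σ₀⁴·E[Δ]. -/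
open MeasureTheory ProbabilityTheory

open Polynomial in
lemma deriv_eval_mul_exp_sq_div_two (p : ℝ[X]) :
    deriv (fun t : ℝ => p.eval t * Real.exp (t ^ 2 / 2)) =
      fun t => (derivative p + X * p).eval t * Real.exp (t ^ 2 / 2) := by
  funext t
  have hexp : HasDerivAt (fun t : ℝ => Real.exp (t ^ 2 / 2)) (Real.exp (t ^ 2 / 2) * t) t := by
    convert ((hasDerivAt_pow 2 t).div_const 2).exp using 2
    simp
  rw [((p.hasDerivAt t).fun_mul hexp).deriv]
  simp only [eval_add, eval_mul, eval_X]
  ring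

open Polynomial in
lemma integral_pow_four_gaussianReal_zero_one : ∫ x, x ^ 4 ∂(gaussianReal 0 1) = 3 := by
  have hmgf : mgf id (gaussianReal 0 1) =
      fun t => (1 : ℝ[X]).eval t * Real.exp (t ^ 2 / 2) := by
    simp [mgf_id_gaussianReal]
  have hmoment := iteratedDeriv_mgf_zero (X := id) (μ := gaussianReal 0 1) (by simp) 4
  rw [hmgf] at hmoment
  simp only [iteratedDeriv_succ, iteratedDeriv_zero, deriv_eval_mul_exp_sq_div_two] at hmoment
  simp at hmoment
  norm_num at hmoment
  exact hmoment.symm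

lemma integral_sq_gaussianReal_zero_one : ∫ x, x ^ 2 ∂(gaussianReal 0 1) = 1 := by
  have hvar := variance_fun_id_gaussianReal (μ := 0) (v := 1)
  rw [variance_of_integral_eq_zero aemeasurable_id' integral_id_gaussianReal] at hvar
  simpa using hvar

lemma integrable_pow_gaussianReal (n : ℕ) : Integrable (fun x => x ^ n) (gaussianReal 0 1) :=
  integrable_pow_of_mem_interior_integrableExpSet (X := id) (by simp) n

/-- Table 1 (MLE of `σ²` with known `θ₀` for the Ornstein–Uhlenbeck process): with the
exact likelihood score `h(v)` for `v = σ²`, one has `E[h(σ₀²)²] = 1/(2σ₀⁴)`,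
`E[∂h/∂v(σ₀²)] = −1/(2σ₀⁴)`, and hence
`E[Δ]·E[h(σ₀²)²]/(E[∂h/∂v(σ₀²)])² = 2σ₀⁴·E[Δ]`. Here `s0` plays the role of `σ₀²`. -/
theorem mle_sigma2_exact_variance
    {Ω : Type*} [MeasurableSpace Ω] (P : Measure Ω) [IsProbabilityMeasure P]
    (θ₀ s0 : ℝ) (hθ₀ : 0 < θ₀) (hs0 : 0 < s0)
    (Y₀ Δ G : Ω → ℝ)
    (hY₀meas : Measurable Y₀) (hΔmeas : Measurable Δ) (hGmeas : Measurable G)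
    (hΔpos : ∀ ω, 0 < Δ ω) (hΔint : Integrable Δ P)
    (hGlaw : P.map G = gaussianReal 0 1)
    (hindep : IndepFun (fun ω => (Y₀ ω, Δ ω)) G P)
    (Y₁ : Ω → ℝ)
    (hY₁ : ∀ ω, Y₁ ω = Real.exp (-θ₀ * Δ ω) * Y₀ ω +
      Real.sqrt (s0 * (1 - Real.exp (-2 * θ₀ * Δ ω)) / (2 * θ₀)) * G ω)
    (h : ℝ → Ω → ℝ)
    (hh : ∀ v ω, 0 < v → h v ω = 1 / (2 * v) *
      ((Y₁ ω - Real.exp (-θ₀ * Δ ω) * Y₀ ω) ^ 2 * (2 * θ₀) /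
          (v * (1 - Real.exp (-2 * θ₀ * Δ ω))) - 1)) :
    (∫ ω, h s0 ω ^ 2 ∂P) = 1 / (2 * s0 ^ 2) ∧
    (∫ ω, deriv (fun v => h v ω) s0 ∂P) = -(1 / (2 * s0 ^ 2)) ∧
    (∫ ω, Δ ω ∂P) * (∫ ω, h s0 ω ^ 2 ∂P) / (∫ ω, deriv (fun v => h v ω) s0 ∂P) ^ 2 =
      2 * s0 ^ 2 * ∫ ω, Δ ω ∂P := by
  have hdecay : ∀ ω, 0 < 1 - Real.exp (-2 * θ₀ * Δ ω) := fun ω => by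
    have : 0 < θ₀ * Δ ω := mul_pos hθ₀ (hΔpos ω)
    rw [sub_pos, Real.exp_lt_one_iff]
    linarith
  have hscore : ∀ ω v, 0 < v → h v ω = 1 / (2 * v) * (s0 * G ω ^ 2 / v - 1) := by
    intro ω v hv
    have hd := hdecay ω
    rw [hh v ω hv, hY₁ ω, add_sub_cancel_left, mul_pow, Real.sq_sqrt (by positivity)]
    generalize 1 - Real.exp (-2 * θ₀ * Δ ω) = d at hd
    field_simp
  have hderiv : ∀ ω, deriv (fun v => h v ω) s0 = 1 / (2 * s0 ^ 2) * (1 - 2 * G ω ^ 2) := by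
    intro ω
    have hev : (fun v => h v ω) =ᶠ[nhds s0]
        fun v => s0 * G ω ^ 2 / 2 * (v ^ 2)⁻¹ - 1 / 2 * v⁻¹ := by
      filter_upwards [lt_mem_nhds hs0] with v hv
      rw [hscore ω v hv]
      field_simp
    have hd : HasDerivAt (fun v => s0 * G ω ^ 2 / 2 * (v ^ 2)⁻¹ - 1 / 2 * v⁻¹) _ s0 :=
      (((hasDerivAt_pow 2 s0).fun_inv (pow_ne_zero 2 hs0.ne')).const_mul _).sub
        ((hasDerivAt_inv hs0.ne').const_mul _)
    rw [hev.deriv_eq, hd.deriv]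
    field_simp
    ring
  have hint : ∀ n : ℕ, Integrable (fun ω => G ω ^ n) P := fun n => by
    have hn := integrable_pow_gaussianReal n
    rw [← hGlaw] at hn
    exact hn.comp_measurable hGmeas
  have hpow : ∀ n : ℕ, ∫ ω, G ω ^ n ∂P = ∫ x, x ^ n ∂(gaussianReal 0 1) := fun n => by
    rw [← hGlaw, integral_map hGmeas.aemeasurable (by fun_prop)]
  have hS : ∫ ω, h s0 ω ^ 2 ∂P = 1 / (2 * s0 ^ 2) := by
    have hsq : ∀ ω, h s0 ω ^ 2 = 1 / (4 * s0 ^ 2) * (G ω ^ 4 - 2 * G ω ^ 2 + 1) := fun ω => by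
      rw [hscore ω s0 hs0]
      field_simp
      ring
    simp_rw [hsq]
    rw [integral_const_mul,
      integral_add ((hint 4).sub' ((hint 2).const_mul 2)) (integrable_const 1),
      integral_sub (hint 4) ((hint 2).const_mul 2), integral_const_mul, hpow, hpow,
      integral_pow_four_gaussianReal_zero_one, integral_sq_gaussianReal_zero_one]
    simp
    field_simp
    norm_num
  have hD : ∫ ω, deriv (fun v => h v ω) s0 ∂P = -(1 / (2 * s0 ^ 2)) := by
    simp_rw [hderiv]
    rw [integral_const_mul, integral_sub (integrable_const 1) ((hint 2).const_mul 2),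
      integral_const_mul, hpow, integral_sq_gaussianReal_zero_one]
    simp
    field_simp
    norm_num
  refine ⟨hS, hD, ?_⟩
  rw [hS, hD]
  field_simp
end
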